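/- For every r ≥ 3 there exists an uncountable set of r-tuples α = (α₁,…,α_r) ∈ ℝ^r, each with 1, α₁, …, α_r linearly independent over ℚ, such that for each such α there exist a sublattice Λ ⊆ ℤ^{r+1} of rank 3 and an index ν₀ with the property that every best approximation m_ν (in the sense of linear form) with ν > ν₀ lies in Λ. -/

import Mathlib

open scoped BigOperators

/-- `ζ(m) = |m₀ + m₁α₁ + … + m_rα_r|` : value of the linear form at the integer point `m`. -/
noncomputable def zetaLF {r : ℕ} (α : Fin r → ℝ) (m : Fin (r + 1) → ℤ) : ℝ :=
  |(m 0 : ℝ) + ∑ j : Fin r, (m j.succ : ℝ) * α j|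

/-- `M(m) = max_j |m_j|`. -/
def heightLF {r : ℕ} (m : Fin (r + 1) → ℤ) : ℕ :=
  Finset.univ.sup fun j => (m j).natAbs

/-- `m ≠ 0` is a best approximation in the sense of linear form:
`ζ(m) = min {ζ(n) : n ≠ 0, M(n) ≤ M(m)}`. -/
def IsBestApproxLF {r : ℕ} (α : Fin r → ℝ) (m : Fin (r + 1) → ℤ) : Prop :=
  m ≠ 0 ∧ ∀ n : Fin (r + 1) → ℤ, n ≠ 0 → heightLF n ≤ heightLF m →
    zetaLF α m ≤ zetaLF α n

/-- `m : ℕ → ℤ^{r+1}` enumerates the best approximations to the linear form given by `α`,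
ordered by strictly increasing height, and exhaustively (every best approximation occurs
at one of the heights `M_ν`). -/
def IsBestApproxSeqLF {r : ℕ} (α : Fin r → ℝ) (m : ℕ → Fin (r + 1) → ℤ) : Prop :=
  (∀ ν : ℕ, IsBestApproxLF α (m ν)) ∧
  (∀ ν : ℕ, heightLF (m ν) < heightLF (m (ν + 1))) ∧
  (∀ n : Fin (r + 1) → ℤ, IsBestApproxLF α n → ∃ ν : ℕ, heightLF (m ν) = heightLF n)

/-- `1, α₁, …, α_r` are linearly independent over `ℚ`. -/
def QIndepLF {r : ℕ} (α : Fin r → ℝ) : Prop :=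
  ∀ c : Fin (r + 1) → ℤ, ((c 0 : ℝ) + ∑ j : Fin r, (c j.succ : ℝ) * α j = 0) → c = 0

/-- A sequence of integers, each dividing the next, growing as fast as prescribed by `ψ`. -/
theorem exists_fast_divisibility_seq (ψ : ℕ → ℝ) (hψ : ∀ n, 0 < ψ n) :
    ∃ c : ℕ → ℕ, c 0 = 2 ∧ (∀ n, c n ∣ c (n + 1)) ∧ (∀ n, (n + 2) * c n ≤ c (n + 1)) ∧
      ∀ n, 2 * (c n : ℝ) ≤ ψ (c n) * c (n + 1) := by
  obtain ⟨c, hc2, hc⟩ : ∃ c : ℕ → ℕ, c 0 = 2 ∧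
      ∀ n, c (n + 1) = c n * (n + 2 + ⌈2 / ψ (c n)⌉₊) :=
    ⟨fun n => Nat.rec 2 (fun k y => y * (k + 2 + ⌈2 / ψ y⌉₊)) n, rfl, fun _ => rfl⟩
  refine ⟨c, hc2, fun n => ⟨_, hc n⟩, fun n => ?_, fun n => ?_⟩
  · rw [hc, mul_comm]
    exact Nat.mul_le_mul_left _ (Nat.le_add_right _ _)
  · have h := Nat.le_ceil (2 / ψ (c n))
    rw [div_le_iff₀ (hψ _)] at h
    rw [hc]
    push_cast
    have h1 : (0 : ℝ) ≤ c n := Nat.cast_nonneg _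
    have h2 : (0 : ℝ) ≤ ψ (c n) * c n * (n + 2) := by have := (hψ (c n)).le; positivity
    nlinarith [mul_le_mul_of_nonneg_right h h1]

section LacunarySeries

variable {c : ℕ → ℕ} {x : ℕ → ℤ} {K : ℝ}

theorem two_pow_mul_le_of_doubling (hc : ∀ n, 2 * c n ≤ c (n + 1)) (N n : ℕ) :
    2 ^ n * c N ≤ c (n + N) := by
  induction n with
  | zero => simp
  | succ n ih =>
    have := hc (n + N)
    rw [show n + 1 + N = n + N + 1 by ring, pow_succ]
    linarith

theorem norm_lacunary_term_le (h0 : ∀ n, 0 < c n) (hc : ∀ n, 2 * c n ≤ c (n + 1))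
    (hx : ∀ n, |(x n : ℝ)| ≤ K) (N n : ℕ) :
    ‖(x (n + N) : ℝ) / c (n + N)‖ ≤ K / c N * (1 / 2) ^ n := by
  have hN : (0 : ℝ) < c N := by exact_mod_cast h0 N
  have h : (2 : ℝ) ^ n * c N ≤ c (n + N) := by
    exact_mod_cast two_pow_mul_le_of_doubling hc N n
  have hK : 0 ≤ K := (abs_nonneg _).trans (hx 0)
  rw [norm_div, Real.norm_eq_abs, Real.norm_natCast, one_div, inv_pow, ← div_eq_mul_inv, div_div,
    mul_comm (c N : ℝ)]
  exact div_le_div₀ hK (hx _) (by positivity) h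

theorem hasSum_geometric_majorant (N : ℕ) :
    HasSum (fun n : ℕ => K / c N * (1 / 2) ^ n) (2 * K / c N) := by
  have h := hasSum_geometric_two.mul_left (K / (c N : ℝ))
  rwa [mul_comm (K / (c N : ℝ)) 2, ← mul_div_assoc] at h

theorem summable_lacunary (h0 : ∀ n, 0 < c n) (hc : ∀ n, 2 * c n ≤ c (n + 1))
    (hx : ∀ n, |(x n : ℝ)| ≤ K) : Summable fun n => (x n : ℝ) / c n :=
  Summable.of_norm_bounded (hasSum_geometric_majorant 0).summable
    fun n => norm_lacunary_term_le h0 hc hx 0 n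

theorem abs_lacunary_sub_partial_le (h0 : ∀ n, 0 < c n) (hc : ∀ n, 2 * c n ≤ c (n + 1))
    (hx : ∀ n, |(x n : ℝ)| ≤ K) (N : ℕ) :
    |∑' n, (x n : ℝ) / c n - ∑ n ∈ Finset.range N, (x n : ℝ) / c n| ≤ 2 * K / c N := by
  rw [← (summable_lacunary h0 hc hx).sum_add_tsum_nat_add N, add_sub_cancel_left]
  exact tsum_of_norm_bounded (hasSum_geometric_majorant N) (norm_lacunary_term_le h0 hc hx N)

theorem exists_int_eq_mul_lacunary_partial (h0 : ∀ n, 0 < c n) (hd : ∀ n, c n ∣ c (n + 1))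
    (x : ℕ → ℤ) (N : ℕ) :
    ∃ p : ℤ, (p : ℝ) = c N * ∑ n ∈ Finset.range (N + 1), (x n : ℝ) / c n := by
  refine ⟨∑ n ∈ Finset.range (N + 1), ((c N / c n : ℕ) : ℤ) * x n, ?_⟩
  rw [Int.cast_sum, Finset.mul_sum]
  refine Finset.sum_congr rfl fun n hn => ?_
  have hdvd : c n ∣ c N := by
    have hle : n ≤ N := Nat.lt_succ_iff.mp (Finset.mem_range.mp hn)
    induction N, hle using Nat.le_induction with
    | base => exact dvd_rfl
    | succ k hk ih => exact (ih (Finset.mem_range.mpr (by omega))).trans (hd k)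
  have hn0 : (c n : ℝ) ≠ 0 := by exact_mod_cast (h0 n).ne'
  rw [Int.cast_mul, Int.cast_natCast, Nat.cast_div hdvd hn0]
  ring

/-- A lacunary series with bounded integral numerators and quotients `c (n + 1) / c n` tending to
infinity is an integer only if its terms are eventually zero. -/
theorem eventually_eq_zero_of_lacunary_eq_int (h0 : ∀ n, 0 < c n) (hd : ∀ n, c n ∣ c (n + 1))
    (hg : ∀ n, (n + 2) * c n ≤ c (n + 1)) (hx : ∀ n, |(x n : ℝ)| ≤ K) (u : ℤ)
    (hu : (u : ℝ) + ∑' n, (x n : ℝ) / c n = 0) : ∃ N₀, ∀ N ≥ N₀, x N = 0 := by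
  have hc : ∀ n, 2 * c n ≤ c (n + 1) := fun n =>
    (Nat.mul_le_mul_right _ (Nat.le_add_left 2 n)).trans (hg n)
  obtain ⟨N₀, hN₀⟩ := exists_nat_gt (2 * K)
  have key : ∀ N ≥ N₀, (u : ℝ) + ∑ n ∈ Finset.range (N + 1), (x n : ℝ) / c n = 0 := by
    intro N hN
    have hcN : (0 : ℝ) < c N := by exact_mod_cast h0 N
    have hcN1 : (0 : ℝ) < c (N + 1) := by exact_mod_cast h0 (N + 1)
    obtain ⟨p, hp⟩ := exists_int_eq_mul_lacunary_partial h0 hd x N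
    have ht := abs_lacunary_sub_partial_le h0 hc hx (N + 1)
    set P := ∑ n ∈ Finset.range (N + 1), (x n : ℝ) / c n
    have hcast : ((c N * u + p : ℤ) : ℝ) = c N * (u + P) := by push_cast; rw [hp]; ring
    have hlt : |((c N * u + p : ℤ) : ℝ)| < 1 := by
      rw [hcast, abs_mul, abs_of_pos hcN, show (u : ℝ) + P = -(∑' n, (x n : ℝ) / c n - P) by
        linarith, abs_neg]
      have hg' : ((N : ℝ) + 2) * c N ≤ c (N + 1) := by exact_mod_cast hg N
      have hNK : 2 * K < N + 2 := by
        have : (N₀ : ℝ) ≤ N := by exact_mod_cast hN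
        linarith
      calc (c N : ℝ) * |∑' n, (x n : ℝ) / c n - P| ≤ c N * (2 * K / c (N + 1)) := by gcongr
        _ = 2 * K * c N / c (N + 1) := by ring
        _ < 1 := by
          rw [div_lt_one hcN1]
          nlinarith
    have hz : (c N * u + p : ℤ) = 0 := by
      rw [← Int.abs_lt_one_iff]
      exact_mod_cast hlt
    rw [hz, Int.cast_zero, eq_comm, mul_eq_zero] at hcast
    exact hcast.resolve_left hcN.ne'
  refine ⟨N₀ + 1, fun N hN => ?_⟩
  obtain ⟨M, rfl⟩ : ∃ M, N = M + 1 := ⟨N - 1, by omega⟩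
  have h1 := key M (by omega)
  have h2 := key (M + 1) (by omega)
  rw [Finset.sum_range_succ, ← add_assoc, h1, zero_add, div_eq_zero_iff] at h2
  have hne : (c (M + 1) : ℝ) ≠ 0 := by exact_mod_cast (h0 (M + 1)).ne'
  exact_mod_cast h2.resolve_right hne

/-- If the term after the `n`-th one vanishes, the `n`-th partial sum is an exceptionally good
rational approximation to a lacunary series with digits in `{0, 1}`. -/
theorem exists_int_approx_lacunary {ψ : ℕ → ℝ} (hc2 : c 0 = 2) (h0 : ∀ n, 0 < c n)
    (hd : ∀ n, c n ∣ c (n + 1)) (hc : ∀ n, 2 * c n ≤ c (n + 1))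
    (hψ : ∀ n, 2 * (c n : ℝ) ≤ ψ (c n) * c (n + 1)) (hx : ∀ n, x n = 0 ∨ x n = 1)
    (n : ℕ) (hn : x (n + 1) = 0) :
    ∃ p : ℤ, |p| ≤ c n ∧ |(c n : ℝ) * ∑' k, (x k : ℝ) / c k - p| ≤ ψ (c (n + 1)) := by
  have hx1 : ∀ n, |(x n : ℝ)| ≤ 1 := fun n => by rcases hx n with h | h <;> simp [h]
  have hx0 : ∀ n, 0 ≤ (x n : ℝ) / c n := fun n => by
    rcases hx n with h | h <;> simp [h]
  have hcn : (0 : ℝ) < c n := by exact_mod_cast h0 n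
  have hcn2 : (0 : ℝ) < c (n + 2) := by exact_mod_cast h0 (n + 2)
  obtain ⟨p, hp⟩ := exists_int_eq_mul_lacunary_partial h0 hd x n
  have hsum := summable_lacunary h0 hc hx1
  have hle := hsum.sum_le_tsum (Finset.range (n + 1)) fun i _ => hx0 i
  have hnn := Finset.sum_nonneg (s := Finset.range (n + 1)) fun i _ => hx0 i
  have h1 := abs_lacunary_sub_partial_le h0 hc hx1 0
  have h2 := abs_lacunary_sub_partial_le h0 hc hx1 (n + 2)
  rw [Finset.sum_range_succ, hn, Int.cast_zero, zero_div, add_zero] at h2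
  rw [Finset.sum_range_zero, sub_zero, hc2] at h1
  norm_num at h1
  refine ⟨p, ?_, ?_⟩
  · have : |(p : ℝ)| ≤ c n := by
      rw [hp, abs_of_nonneg (by positivity)]
      nlinarith [le_of_abs_le h1]
    exact_mod_cast this
  · rw [hp, ← mul_sub, abs_mul, abs_of_pos hcn]
    have hmono : (c n : ℝ) ≤ c (n + 1) := by
      exact_mod_cast (Nat.le_mul_of_pos_left _ two_pos).trans (hc n)
    calc (c n : ℝ) * _ ≤ c (n + 1) * (2 * 1 / c (n + 2)) := by gcongr
      _ = 2 * c (n + 1) / c (n + 2) := by ring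
      _ ≤ ψ (c (n + 1)) := by
        rw [div_le_iff₀ hcn2]
        exact hψ (n + 1)

end LacunarySeries

/-- Khintchine's theorem: pairs of numbers, independent together with `1`, whose linear form
is uniformly approximable to any prescribed order. -/
theorem exists_singular_pair (ψ : ℕ → ℝ) (hψ : ∀ n, 0 < ψ n) (hanti : Antitone ψ) :
    ∃ a b : ℝ, (∀ u v w : ℤ, (u : ℝ) + v * a + w * b = 0 → u = 0 ∧ v = 0 ∧ w = 0) ∧
      ∀ X : ℕ, 2 ≤ X → ∃ u v w : ℤ, (v ≠ 0 ∨ w ≠ 0) ∧ |u| ≤ X ∧ |v| ≤ X ∧ |w| ≤ X ∧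
        |(u : ℝ) + v * a + w * b| ≤ ψ X := by
  obtain ⟨c, hc2, hd, hg, hcψ⟩ := exists_fast_divisibility_seq ψ hψ
  have hc : ∀ n, 2 * c n ≤ c (n + 1) := fun n =>
    (Nat.mul_le_mul_right _ (Nat.le_add_left 2 n)).trans (hg n)
  have hbig : ∀ n, n < c n := fun n => by
    have h := two_pow_mul_le_of_doubling hc 0 n
    rw [hc2, add_zero] at h
    have := n.lt_two_pow_self
    omega
  have h0 : ∀ n, 0 < c n := fun n => (Nat.zero_le n).trans_lt (hbig n)
  let x : ℕ → ℤ := fun n => if Even n then 1 else 0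
  let y : ℕ → ℤ := fun n => if Even n then 0 else 1
  have hx : ∀ n, x n = 0 ∨ x n = 1 := fun n => by by_cases h : Even n <;> simp [x, h]
  have hy : ∀ n, y n = 0 ∨ y n = 1 := fun n => by by_cases h : Even n <;> simp [y, h]
  have hx1 : ∀ n, |(x n : ℝ)| ≤ 1 := fun n => by rcases hx n with h | h <;> simp [h]
  have hy1 : ∀ n, |(y n : ℝ)| ≤ 1 := fun n => by rcases hy n with h | h <;> simp [h]
  refine ⟨∑' n, (x n : ℝ) / c n, ∑' n, (y n : ℝ) / c n, ?_, ?_⟩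
  · intro u v w h
    have hsum : ∑' n, ((v * x n + w * y n : ℤ) : ℝ) / c n
        = v * ∑' n, (x n : ℝ) / c n + w * ∑' n, (y n : ℝ) / c n := by
      rw [← tsum_mul_left, ← tsum_mul_left,
        ← ((summable_lacunary h0 hc hx1).mul_left _).tsum_add
          ((summable_lacunary h0 hc hy1).mul_left _)]
      refine tsum_congr fun n => ?_
      push_cast
      ring
    have hK : ∀ n, |((v * x n + w * y n : ℤ) : ℝ)| ≤ |(v : ℝ)| + |(w : ℝ)| := fun n => by
      push_cast
      refine (abs_add_le _ _).trans ?_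
      rw [abs_mul, abs_mul]
      exact add_le_add (mul_le_of_le_one_right (abs_nonneg _) (hx1 n))
        (mul_le_of_le_one_right (abs_nonneg _) (hy1 n))
    obtain ⟨N, hN⟩ := eventually_eq_zero_of_lacunary_eq_int (x := fun n => v * x n + w * y n)
      h0 hd hg hK u (by rw [hsum]; linarith)
    have hv : v = 0 := by simpa [x, y] using hN (2 * N) (by omega)
    have hw : w = 0 := by simpa [x, y] using hN (2 * N + 1) (by omega)
    refine ⟨?_, hv, hw⟩
    rw [hv, hw] at h
    simpa using h
  · intro X hX
    have hex : ∃ n, X < c n := ⟨X, hbig X⟩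
    obtain ⟨n, hn⟩ : ∃ n, Nat.find hex = n + 1 := by
      refine Nat.exists_eq_succ_of_ne_zero fun h => ?_
      have := Nat.find_spec hex
      rw [h] at this
      omega
    have hlo : c n ≤ X := not_lt.mp (Nat.find_min hex (by omega))
    have hhi : X < c (n + 1) := hn ▸ Nat.find_spec hex
    have hcne : (c n : ℤ) ≠ 0 := by exact_mod_cast (h0 n).ne'
    have hcX : |(c n : ℤ)| ≤ X := by
      rw [Nat.abs_cast]
      exact_mod_cast hlo
    have hloZ : (c n : ℤ) ≤ X := by exact_mod_cast hlo
    by_cases he : Even n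
    · obtain ⟨p, hp, hap⟩ := exists_int_approx_lacunary hc2 h0 hd hc hcψ hx n
        (by simp [x, he, Nat.even_add_one])
      refine ⟨-p, c n, 0, Or.inl hcne, by rw [abs_neg]; omega, hcX, by simp, ?_⟩
      refine le_trans (le_of_eq ?_) (hap.trans (hanti hhi.le))
      push_cast
      congr 1
      ring
    · obtain ⟨p, hp, hap⟩ := exists_int_approx_lacunary hc2 h0 hd hc hcψ hy n
        (by simp [y, he, Nat.even_add_one])
      refine ⟨-p, 0, c n, Or.inr hcne, by rw [abs_neg]; omega, by simp, hcX, ?_⟩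
      refine le_trans (le_of_eq ?_) (hap.trans (hanti hhi.le))
      push_cast
      congr 1
      ring

theorem heightLF_le_iff {r : ℕ} {m : Fin (r + 1) → ℤ} {H : ℕ} :
    heightLF m ≤ H ↔ ∀ j, |m j| ≤ H := by
  simp only [heightLF, Finset.sup_le_iff, Finset.mem_univ, true_imp_iff, Int.abs_eq_natAbs,
    Nat.cast_le]

theorem exists_antitone_summable_height (r : ℕ) :
    ∃ ψ : ℕ → ℝ, (∀ n, 0 < ψ n) ∧ Antitone ψ ∧
      ∑' m : Fin (r + 1) → ℤ, ENNReal.ofReal (ψ (heightLF m)) ≠ ⊤ := by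
  obtain ⟨w, hw, hsum⟩ := ENNReal.exists_pos_sum_of_countable (ε := 1) one_ne_zero
    (Fin (r + 1) → ℤ)
  let B : ℕ → Finset (Fin (r + 1) → ℤ) := fun H => Finset.Icc (fun _ => -(H : ℤ)) fun _ => H
  have hmem : ∀ H m, m ∈ B H ↔ heightLF m ≤ H := fun H m => by
    simp only [B, Finset.mem_Icc, Pi.le_def, heightLF_le_iff, abs_le, forall_and]
  have hne : ∀ H, (B H).Nonempty := fun H => ⟨0, (hmem _ _).2 (heightLF_le_iff.2 (by simp))⟩
  refine ⟨fun H => (B H).inf' (hne H) fun m => (w m : ℝ), fun H => ?_, fun H H' h => ?_, ?_⟩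
  · rw [Finset.lt_inf'_iff]
    exact fun m _ => hw m
  · exact Finset.inf'_mono _ (fun m hm => (hmem _ _).2 (((hmem _ _).1 hm).trans h)) (hne H)
  · refine ne_top_of_le_ne_top (hsum.trans ENNReal.one_lt_top).ne (ENNReal.tsum_le_tsum fun m => ?_)
    rw [← ENNReal.ofReal_coe_nnreal]
    exact ENNReal.ofReal_le_ofReal (Finset.inf'_le _ ((hmem _ _).2 le_rfl))

theorem volume_abs_add_mul_le (A : ℝ) {k : ℤ} (hk : k ≠ 0) (ε : ℝ) :
    MeasureTheory.volume {t : ℝ | |A + k * t| ≤ ε} ≤ 2 * ENNReal.ofReal ε := by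
  have hk1 : (1 : ℝ) ≤ |(k : ℝ)| := by exact_mod_cast Int.one_le_abs hk
  have hk0 : (k : ℝ) ≠ 0 := by exact_mod_cast hk
  have hsub : {t : ℝ | |A + k * t| ≤ ε} ⊆ Metric.closedBall (-A / k) ε := by
    intro t ht
    rw [Metric.mem_closedBall, Real.dist_eq]
    have heq : A + k * t = k * (t - -A / k) := by field_simp; ring
    rw [Set.mem_ofPred_eq, heq, abs_mul] at ht
    exact (le_mul_of_one_le_left (abs_nonneg _) hk1).trans ht
  refine (MeasureTheory.measure_mono hsub).trans ?_
  rw [Real.volume_closedBall, ENNReal.ofReal_mul zero_le_two, ENNReal.ofReal_ofNat]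

theorem zetaLF_update {r : ℕ} (α : Fin r → ℝ) (k : Fin r) (t : ℝ) (m : Fin (r + 1) → ℤ) :
    zetaLF (Function.update α k t) m =
      |((m 0 : ℝ) + ∑ j ∈ Finset.univ.erase k, (m j.succ : ℝ) * α j) + (m k.succ : ℤ) * t| := by
  rw [zetaLF, ← Finset.sum_erase_add _ _ (Finset.mem_univ k), Function.update_self, ← add_assoc]
  have hsum : ∀ j ∈ Finset.univ.erase k,
      (m j.succ : ℝ) * Function.update α k t j = m j.succ * α j := fun j hj => by
    rw [Function.update_of_ne (Finset.ne_of_mem_erase hj)]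
  rw [Finset.sum_congr rfl hsum]

theorem zetaLF_update_of_eq_zero {r : ℕ} (α : Fin r → ℝ) {k : Fin r} (t : ℝ)
    {m : Fin (r + 1) → ℤ} (hm : m k.succ = 0) :
    zetaLF (Function.update α k t) m = zetaLF α m := by
  rw [← congrArg (zetaLF · m) (Function.update_eq_self k α), zetaLF_update, zetaLF_update, hm]
  simp

/-- The integer points that involve only coordinates in `T ∪ T'`, involve one in `T`, and at which
the linear form is at most `ψ` of the height. -/
def closePoints {r : ℕ} (ψ : ℕ → ℝ) (T' T : Finset (Fin r)) (α : Fin r → ℝ) :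
    Set (Fin (r + 1) → ℤ) :=
  {m | (∀ j, j ∉ T' → j ∉ T → m j.succ = 0) ∧ (∃ j ∈ T, m j.succ ≠ 0) ∧
    zetaLF α m ≤ ψ (heightLF m)}

theorem ae_finite_closePoints_update {r : ℕ} {ψ : ℕ → ℝ}
    (hψ : ∑' m : Fin (r + 1) → ℤ, ENNReal.ofReal (ψ (heightLF m)) ≠ ⊤)
    {T' T : Finset (Fin r)} {α : Fin r → ℝ} (hfin : (closePoints ψ T' T α).Finite) (k : Fin r) :
    ∀ᵐ t : ℝ, (closePoints ψ T' (insert k T) (Function.update α k t)).Finite := by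
  let s : (Fin (r + 1) → ℤ) → Set ℝ := fun m =>
    {t | m k.succ ≠ 0 ∧ zetaLF (Function.update α k t) m ≤ ψ (heightLF m)}
  have hs : ∀ m, MeasureTheory.volume (s m) ≤ 2 * ENNReal.ofReal (ψ (heightLF m)) := fun m => by
    by_cases hm : m k.succ = 0
    · simp [s, hm]
    · refine le_trans (MeasureTheory.measure_mono fun t ht => ?_) (volume_abs_add_mul_le
        (m 0 + ∑ j ∈ Finset.univ.erase k, (m j.succ : ℝ) * α j) hm _)
      rw [Set.mem_ofPred_eq, ← zetaLF_update]
      exact ht.2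
  have htop : ∑' m, MeasureTheory.volume (s m) ≠ ⊤ := by
    refine ne_top_of_le_ne_top ?_ (ENNReal.tsum_le_tsum hs)
    rw [ENNReal.tsum_mul_left]
    exact ENNReal.mul_ne_top ENNReal.ofNat_ne_top hψ
  filter_upwards [MeasureTheory.ae_finite_setOfPred_mem htop] with t ht
  refine (ht.union hfin).subset ?_
  rintro m ⟨h1, ⟨j, hj, hmj⟩, h3⟩
  by_cases hm : m k.succ = 0
  · refine Or.inr ⟨fun i hi hi' => ?_, ⟨j, ?_, hmj⟩, ?_⟩
    · by_cases hik : i = k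
      · rwa [hik]
      · exact h1 i hi (by simp [hik, hi'])
    · refine (Finset.mem_insert.1 hj).resolve_left ?_
      rintro rfl
      exact hmj hm
    · rwa [zetaLF_update_of_eq_zero α t hm] at h3
  · exact Or.inl ⟨hm, h3⟩

theorem exists_finite_closePoints {r : ℕ} {ψ : ℕ → ℝ}
    (hψ : ∑' m : Fin (r + 1) → ℤ, ENNReal.ofReal (ψ (heightLF m)) ≠ ⊤)
    (T' : Finset (Fin r)) (α : Fin r → ℝ) (T : Finset (Fin r)) (hT : Disjoint T T') :
    ∃ β : Fin r → ℝ, (∀ j ∈ T', β j = α j) ∧ (closePoints ψ T' T β).Finite := by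
  induction T using Finset.induction_on with
  | empty => exact ⟨α, fun _ _ => rfl, by simp [closePoints]⟩
  | insert k T hk ih =>
    obtain ⟨hkT', hT⟩ := Finset.disjoint_insert_left.1 hT
    obtain ⟨β, hβ, hfin⟩ := ih hT
    obtain ⟨t, ht⟩ := (ae_finite_closePoints_update hψ hfin k).exists
    refine ⟨_, fun j hj => ?_, ht⟩
    rw [Function.update_of_ne (ne_of_mem_of_not_mem hj hkT'), hβ j hj]

theorem zetaLF_smul {r : ℕ} (α : Fin r → ℝ) (N : ℤ) (m : Fin (r + 1) → ℤ) :
    zetaLF α (N • m) = |(N : ℝ)| * zetaLF α m := by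
  simp only [zetaLF, ← abs_mul, mul_add, Finset.mul_sum, Pi.smul_apply, smul_eq_mul, Int.cast_mul,
    mul_assoc]

theorem zetaLF_eq_of_support_pair {r : ℕ} (α : Fin r → ℝ) {i₀ i₁ : Fin r} (h01 : i₀ ≠ i₁)
    {m : Fin (r + 1) → ℤ} (hm : ∀ j, j ≠ i₀ → j ≠ i₁ → m j.succ = 0) :
    zetaLF α m = |(m 0 : ℝ) + m i₀.succ * α i₀ + m i₁.succ * α i₁| := by
  rw [zetaLF, Fintype.sum_eq_add i₀ i₁ h01 (fun j hj => by simp [hm j hj.1 hj.2]), add_assoc]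

/-- Finiteness of the close points forces linear independence over `ℚ`. -/
theorem qIndepLF_of_finite_closePoints {r : ℕ} {ψ : ℕ → ℝ} (hψ : ∀ n, 0 < ψ n) {α : Fin r → ℝ}
    {i₀ i₁ : Fin r} (h01 : i₀ ≠ i₁)
    (hind : ∀ u v w : ℤ, (u : ℝ) + v * α i₀ + w * α i₁ = 0 → u = 0 ∧ v = 0 ∧ w = 0)
    (hfin : (closePoints ψ {i₀, i₁} {i₀, i₁}ᶜ α).Finite) : QIndepLF α := by
  intro c hc
  have hz : zetaLF α c = 0 := by rw [zetaLF, hc, abs_zero]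
  have hsupp : ∀ j, j ≠ i₀ → j ≠ i₁ → c j.succ = 0 := by
    by_contra! hcon
    obtain ⟨j, hj0, hj1, hj⟩ := hcon
    have hinj : Function.Injective fun N : ℕ => ((N : ℤ) + 1) • c := fun N N' h => by
      have := congrFun h j.succ
      simpa [hj] using this
    refine Set.infinite_of_injective_forall_mem hinj (fun N => ?_) hfin
    refine ⟨fun i hi hi' => absurd (Finset.mem_compl.2 hi) hi', ⟨j, by simp [hj0, hj1], ?_⟩, ?_⟩
    · rw [Pi.smul_apply, smul_eq_mul]
      exact mul_ne_zero (by positivity) hj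
    · rw [zetaLF_smul, hz, mul_zero]
      exact (hψ _).le
  rw [zetaLF_eq_of_support_pair α h01 hsupp, abs_eq_zero] at hz
  obtain ⟨h0, h1, h2⟩ := hind _ _ _ hz
  funext i
  refine Fin.cases h0 (fun j => ?_) i
  by_cases hj0 : j = i₀
  · rwa [hj0]
  by_cases hj1 : j = i₁
  · rwa [hj1]
  exact hsupp j hj0 hj1

/-- A best approximation that is not a close point lies in the rank-3 coordinate lattice in which
the linear form is uniformly small. -/
theorem IsBestApproxLF.eq_zero_of_notMem_closePoints {r : ℕ} {ψ : ℕ → ℝ} {α : Fin r → ℝ}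
    {i₀ i₁ : Fin r} (h01 : i₀ ≠ i₁)
    (hsing : ∀ X : ℕ, 2 ≤ X → ∃ u v w : ℤ, (v ≠ 0 ∨ w ≠ 0) ∧ |u| ≤ X ∧ |v| ≤ X ∧ |w| ≤ X ∧
      |(u : ℝ) + v * α i₀ + w * α i₁| ≤ ψ X)
    {m : Fin (r + 1) → ℤ} (hm : IsBestApproxLF α m) (hH : 2 ≤ heightLF m)
    (hmem : m ∉ closePoints ψ {i₀, i₁} {i₀, i₁}ᶜ α) {j : Fin r} (hj0 : j ≠ i₀) (hj1 : j ≠ i₁) :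
    m j.succ = 0 := by
  by_contra hj
  refine hmem ⟨fun i hi hi' => absurd (Finset.mem_compl.2 hi) hi', ⟨j, by simp [hj0, hj1], hj⟩, ?_⟩
  obtain ⟨u, v, w, hvw, hu, hv, hw, hle⟩ := hsing _ hH
  let n : Fin (r + 1) → ℤ :=
    Fin.cons u fun i : Fin r => if i = i₀ then v else if i = i₁ then w else 0
  have hn0 : n i₀.succ = v := by simp [n]
  have hn1 : n i₁.succ = w := by simp [n, h01.symm]
  have hsupp : ∀ j, j ≠ i₀ → j ≠ i₁ → n j.succ = 0 := fun j h h' => by simp [n, h, h']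
  have hne : n ≠ 0 := by
    intro h
    rw [h] at hn0 hn1
    rcases hvw with h' | h'
    · exact h' hn0.symm
    · exact h' hn1.symm
  refine (hm.2 n hne (heightLF_le_iff.2 fun i => ?_)).trans ?_
  · refine Fin.cases hu (fun k => ?_) i
    by_cases hk0 : k = i₀
    · rwa [hk0, hn0]
    by_cases hk1 : k = i₁
    · rwa [hk1, hn1]
    rw [hsupp k hk0 hk1]
    simp
  · rw [zetaLF_eq_of_support_pair α h01 hsupp, hn0, hn1]
    exact hle

/-- The lattice of integer points supported on the first `k` coordinates has rank `k`. -/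
theorem exists_submodule_finrank_of_support {k n : ℕ} (h : k ≤ n) :
    ∃ Λ : Submodule ℤ (Fin n → ℤ), Module.finrank ℤ Λ = k ∧
      ∀ m : Fin n → ℤ, (∀ i : Fin n, k ≤ i.val → m i = 0) → m ∈ Λ := by
  have hinj : Function.Injective (Fin.castLE h) := Fin.castLE_injective h
  refine ⟨LinearMap.range (Function.ExtendByZero.linearMap ℤ (Fin.castLE h)), ?_, fun m hm => ?_⟩
  · rw [LinearMap.finrank_range_of_inj, Module.finrank_fin_fun]
    intro f g hfg
    funext i
    have := congrFun hfg (Fin.castLE h i)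
    change Function.extend (Fin.castLE h) f 0 _ = Function.extend (Fin.castLE h) g 0 _ at this
    rwa [hinj.extend_apply, hinj.extend_apply] at this
  · refine ⟨fun i => m (Fin.castLE h i), funext fun i => ?_⟩
    change Function.extend (Fin.castLE h) (fun i => m (Fin.castLE h i)) 0 i = m i
    by_cases hi : i.val < k
    · exact hinj.extend_apply (fun i => m (Fin.castLE h i)) 0 ⟨i.val, hi⟩
    · rw [Function.extend_apply', hm i (not_lt.1 hi), Pi.zero_apply]
      rintro ⟨j, rfl⟩
      exact hi j.isLt

theorem not_countable_image_of_ae {β : Type*} {f : ℝ → β} (hf : Function.Injective f)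
    {p : ℝ → Prop} (hp : ∀ᵐ t, p t) : ¬ (f '' {t | p t}).Countable := by
  intro hcount
  have hnull : MeasureTheory.volume {t | p t} = 0 :=
    (Set.countable_of_injective_of_countable_image hf.injOn hcount).measure_zero _
  have hfalse : ∀ᵐ t : ℝ, False := by
    filter_upwards [hp, MeasureTheory.measure_eq_zero_iff_ae_notMem.1 hnull] with t h h'
    exact h' h
  simpa using hfalse.exists

/-- For every `r ≥ 3` there is an uncountable set of `r`-tuples `α`,
each with `1, α₁, …, α_r` linearly independent over `ℚ`, such that all but finitely many
best approximations (in the sense of linear form) lie in a rank-3 sublattice of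
`ℤ^{r+1}`. -/
theorem stmt1 (r : ℕ) (hr : 3 ≤ r) :
    ∃ S : Set (Fin r → ℝ), ¬ S.Countable ∧
      ∀ α ∈ S, QIndepLF α ∧
        ∃ Λ : Submodule ℤ (Fin (r + 1) → ℤ), Module.finrank ℤ Λ = 3 ∧
          ∀ m : ℕ → Fin (r + 1) → ℤ, IsBestApproxSeqLF α m →
            ∃ ν₀ : ℕ, ∀ ν > ν₀, m ν ∈ Λ := by
  obtain ⟨ψ, hψ, hanti, hsum⟩ := exists_antitone_summable_height r
  obtain ⟨a, b, hind, hsing⟩ := exists_singular_pair ψ hψ hanti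
  let i₀ : Fin r := ⟨0, by omega⟩
  let i₁ : Fin r := ⟨1, by omega⟩
  let i₂ : Fin r := ⟨2, by omega⟩
  have h01 : i₀ ≠ i₁ := by simp [i₀, i₁]
  have h02 : i₀ ≠ i₂ := by simp [i₀, i₂]
  have h12 : i₁ ≠ i₂ := by simp [i₁, i₂]
  obtain ⟨β, hβ, hfin⟩ := exists_finite_closePoints hsum {i₀, i₁}
    (Function.update (fun _ => b) i₀ a) ({i₀, i₁}ᶜ) disjoint_compl_left
  have hβ0 : β i₀ = a := by rw [hβ i₀ (by simp), Function.update_self]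
  have hβ1 : β i₁ = b := by rw [hβ i₁ (by simp), Function.update_of_ne h01.symm]
  have hae := ae_finite_closePoints_update hsum hfin i₂
  have hmem₂ : i₂ ∈ ({i₀, i₁} : Finset (Fin r))ᶜ := by simp [h02.symm, h12.symm]
  rw [Finset.insert_eq_of_mem hmem₂] at hae
  refine ⟨_, not_countable_image_of_ae (Function.update_injective β i₂) hae, ?_⟩
  rintro _ ⟨t, ht, rfl⟩
  set α := Function.update β i₂ t
  have hα0 : α i₀ = a := by rw [← hβ0]; exact Function.update_of_ne h02 _ _
  have hα1 : α i₁ = b := by rw [← hβ1]; exact Function.update_of_ne h12 _ _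
  rw [← hα0, ← hα1] at hind hsing
  obtain ⟨Λ, hΛ, hmem⟩ := exists_submodule_finrank_of_support (show 3 ≤ r + 1 by omega)
  refine ⟨qIndepLF_of_finite_closePoints hψ h01 hind ht, Λ, hΛ, fun m ⟨hbest, hlt, _⟩ => ?_⟩
  have hmono : StrictMono fun ν => heightLF (m ν) := strictMono_nat_of_lt_succ hlt
  have hinj : Function.Injective m := fun ν μ h => hmono.injective (congrArg heightLF h)
  obtain ⟨ν₀, hν₀⟩ := (ht.preimage hinj.injOn).bddAbove
  refine ⟨max ν₀ 2, fun ν hν => hmem _ fun i hi => ?_⟩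
  have hnot : m ν ∉ closePoints ψ {i₀, i₁} {i₀, i₁}ᶜ α := fun h =>
    absurd (hν₀ h) (not_le.2 ((le_max_left _ _).trans_lt hν))
  have hheight : 2 ≤ heightLF (m ν) :=
    ((le_max_right ν₀ 2).trans hν.le).trans (hmono.id_le ν)
  obtain ⟨j, rfl⟩ := Fin.exists_succ_eq.2 (show i ≠ 0 by rintro rfl; simp at hi)
  rw [Fin.val_succ] at hi
  refine (hbest ν).eq_zero_of_notMem_closePoints h01 hsing hheight hnot ?_ ?_
  all_goals
    intro h
    simp [h, i₀, i₁] at hi
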